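/- arXiv:1412.5142 — 4 statements merged into one kernel-verified Lean document; each statement's English description precedes it below -/
import Mathlib

section
/- For all y ∈ E₃ and all x ∈ ℍ(ℂ), f₁(yx) = f₁(y)f₁(x) and f₂(yx) = f₂(y)f₂(x); moreover f₁ and f₂ are continuous, and in fact |f₁(a)| ≤ 2‖a‖ and |f₂(a)| ≤ 2‖a‖ for every a ∈ ℍ(ℂ). -/
open Filter Set Topology Quaternion

noncomputable section

abbrev HC : Type := ℍ[ℂ, -1, -1]

/-- The idempotent `e₁ = (1 + iI)/2`. -/
def e1 : HC := ⟨1/2, Complex.I/2, 0, 0⟩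
/-- The idempotent `e₂ = (1 - iI)/2`. -/
def e2 : HC := ⟨1/2, -(Complex.I/2), 0, 0⟩
/-- `e₃ = (iJ - K)/2`. -/
def e3 : HC := ⟨0, 0, Complex.I/2, -(1/2)⟩
/-- `e₄ = (iJ + K)/2`. -/
def e4 : HC := ⟨0, 0, Complex.I/2, 1/2⟩

/-- Topology on `ℍ(ℂ)` induced from the four complex coordinates. -/
instance : TopologicalSpace HC :=
  TopologicalSpace.induced (fun q : HC => (q.re, q.imI, q.imJ, q.imK)) inferInstance

/-- Coordinate of `a ∈ ℍ(ℂ)` at `e₁` in the basis `{e₁, e₂, e₃, e₄}`. -/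
def c1 (a : HC) : ℂ := a.re - Complex.I * a.imI
/-- Coordinate at `e₂`. -/
def c2 (a : HC) : ℂ := a.re + Complex.I * a.imI
/-- Coordinate at `e₃`. -/
def c3 (a : HC) : ℂ := -(Complex.I * a.imJ) - a.imK
/-- Coordinate at `e₄`. -/
def c4 (a : HC) : ℂ := -(Complex.I * a.imJ) + a.imK

/-- The norm `‖a‖ = √(|a₁|² + |a₂|² + |a₃|² + |a₄|²)`, coordinates in the basis `{e₁,e₂,e₃,e₄}`. -/
def qnorm (a : HC) : ℝ :=
  Real.sqrt (‖c1 a‖ ^ 2 + ‖c2 a‖ ^ 2 +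
    ‖c3 a‖ ^ 2 + ‖c4 a‖ ^ 2)

/-- `f₁ : ℍ(ℂ) → ℂ`, the ℂ-linear functional with `f₁(e₁) = f₁(e₃) = 1`, `f₁(e₂) = f₁(e₄) = 0`. -/
def f1 (a : HC) : ℂ := c1 a + c3 a
/-- `f₂ : ℍ(ℂ) → ℂ`, with `f₂(e₂) = f₂(e₄) = 1`, `f₂(e₁) = f₂(e₃) = 0`. -/
def f2 (a : HC) : ℂ := c2 a + c4 a
/-- `f̂₁ : ℍ(ℂ) → ℂ`, with `f̂₁(e₁) = f̂₁(e₄) = 1`, `f̂₁(e₂) = f̂₁(e₃) = 0`. -/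
def fh1 (a : HC) : ℂ := c1 a + c4 a
/-- `f̂₂ : ℍ(ℂ) → ℂ`, with `f̂₂(e₂) = f̂₂(e₃) = 1`, `f̂₂(e₁) = f̂₂(e₄) = 0`. -/
def fh2 (a : HC) : ℂ := c2 a + c3 a

/-- `ζ = x i₁ + y i₂ + z i₃` for `p = (x, y, z) ∈ ℝ³` (with `i₁ = 1`). -/
def zeta (i2 i3 : HC) (p : ℝ × ℝ × ℝ) : HC :=
  (p.1 : ℂ) • (1 : HC) + (p.2.1 : ℂ) • i2 + (p.2.2 : ℂ) • i3

/-- The real linear span `E₃` of `i₁ = 1, i₂, i₃`. -/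
def E3 (i2 i3 : HC) : Set HC := Set.range (zeta i2 i3)

/-- `i₁ = 1, i₂, i₃` are linearly independent over `ℝ`. -/
def LinIndep (i2 i3 : HC) : Prop :=
  ∀ α₁ α₂ α₃ : ℝ, (α₁ : ℂ) • (1 : HC) + (α₂ : ℂ) • i2 + (α₃ : ℂ) • i3 = 0 →
    α₁ = 0 ∧ α₂ = 0 ∧ α₃ = 0

/-- `Φ` is right-G-monogenic on `S` (w.r.t. directions in `E₃`): it is continuous on `S` and at
every `ζ ∈ S` there is `Φ'(ζ)` with `lim_{ε→0+} (Φ(ζ+εh) − Φ(ζ))ε⁻¹ = h·Φ'(ζ)` for all `h ∈ E₃`. -/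
def RightGMonogenic (i2 i3 : HC) (Φ : HC → HC) (S : Set HC) : Prop :=
  ContinuousOn Φ S ∧ ∀ ζ ∈ S, ∃ Φ' : HC, ∀ h ∈ E3 i2 i3,
    Tendsto (fun ε : ℝ => ((ε : ℂ))⁻¹ • (Φ (ζ + (ε : ℂ) • h) - Φ ζ))
      (nhdsWithin 0 (Set.Ioi 0)) (nhds (h * Φ'))

/-- `Φ̂` is left-G-monogenic on `S`. -/
def LeftGMonogenic (i2 i3 : HC) (Φ : HC → HC) (S : Set HC) : Prop :=
  ContinuousOn Φ S ∧ ∀ ζ ∈ S, ∃ Φ' : HC, ∀ h ∈ E3 i2 i3,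
    Tendsto (fun ε : ℝ => ((ε : ℂ))⁻¹ • (Φ (ζ + (ε : ℂ) • h) - Φ ζ))
      (nhdsWithin 0 (Set.Ioi 0)) (nhds (Φ' * h))

/-- The right maximal ideal `𝓘₁ = {λ₂e₂ + λ₄e₄}`. -/
def I1 : Set HC := {a | ∃ l2 l4 : ℂ, a = l2 • e2 + l4 • e4}
/-- The right maximal ideal `𝓘₂ = {λ₁e₁ + λ₃e₃}`. -/
def I2 : Set HC := {a | ∃ l1 l3 : ℂ, a = l1 • e1 + l3 • e3}
/-- The left maximal ideal `𝓘̂₁ = {λ₂e₂ + λ₃e₃}`. -/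
def Ih1 : Set HC := {a | ∃ l2 l3 : ℂ, a = l2 • e2 + l3 • e3}
/-- The left maximal ideal `𝓘̂₂ = {λ₁e₁ + λ₄e₄}`. -/
def Ih2 : Set HC := {a | ∃ l1 l4 : ℂ, a = l1 • e1 + l4 • e4}

/-- The line `L` in `ℝ³` given by `x + y·Re a + z·Re b = 0`, `y·Im a + z·Im b = 0`. -/
def lineL (a b : ℂ) : Set (ℝ × ℝ × ℝ) :=
  {p | p.1 + p.2.1 * a.re + p.2.2 * b.re = 0 ∧ p.2.1 * a.im + p.2.2 * b.im = 0}

/-- `Ω` is convex in the direction of the line `L` (a line through the origin): it contains every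
segment parallel to `L` joining two of its points. -/
def ConvexInDirection (Ω : Set (ℝ × ℝ × ℝ)) (L : Set (ℝ × ℝ × ℝ)) : Prop :=
  ∀ p ∈ Ω, ∀ q ∈ Ω, q - p ∈ L → segment ℝ p q ⊆ Ω

/-- `ξ = x + y·a + z·b` for `p = (x,y,z)`. -/
def xi (a b : ℂ) (p : ℝ × ℝ × ℝ) : ℂ := (p.1 : ℂ) + (p.2.1 : ℂ) * a + (p.2.2 : ℂ) * b


/-- `Φ'` is a right Gateaux derivative of `Φ` on `S` (directions in `E₃`). -/
def IsRightGDeriv (i2 i3 : HC) (Φ Φ' : HC → HC) (S : Set HC) : Prop :=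
  ∀ ζ ∈ S, ∀ h ∈ E3 i2 i3,
    Tendsto (fun ε : ℝ => ((ε : ℂ))⁻¹ • (Φ (ζ + (ε : ℂ) • h) - Φ ζ))
      (nhdsWithin 0 (Set.Ioi 0)) (nhds (h * Φ' ζ))

/-- `Φ'` is a left Gateaux derivative of `Φ` on `S`. -/
def IsLeftGDeriv (i2 i3 : HC) (Φ Φ' : HC → HC) (S : Set HC) : Prop :=
  ∀ ζ ∈ S, ∀ h ∈ E3 i2 i3,
    Tendsto (fun ε : ℝ => ((ε : ℂ))⁻¹ • (Φ (ζ + (ε : ℂ) • h) - Φ ζ))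
      (nhdsWithin 0 (Set.Ioi 0)) (nhds (Φ' ζ * h))

/-- Triples `(α, β, γ)` of naturals with `α + β + γ = n`. -/
def trip (n : ℕ) : Finset (ℕ × ℕ × ℕ) :=
  (Finset.range (n + 1) ×ˢ Finset.range (n + 1) ×ˢ Finset.range (n + 1)).filter
    (fun u => u.1 + u.2.1 + u.2.2 = n)

/-- Lemma 1, right part: the functionals `f₁, f₂` are right-multiplicative on
`E₃ × ℍ(ℂ)`, continuous, and bounded by `2‖·‖`. -/
theorem statement0 (a₁ a₂ b₁ b₂ : ℂ) (i2 i3 : HC)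
    (hi2 : i2 = a₁ • e1 + a₂ • e2) (hi3 : i3 = b₁ • e1 + b₂ • e2)
    (hLI : LinIndep i2 i3) :
    (∀ y ∈ E3 i2 i3, ∀ x : HC,
        f1 (y * x) = f1 y * f1 x ∧ f2 (y * x) = f2 y * f2 x) ∧
    Continuous f1 ∧ Continuous f2 ∧
    (∀ a : HC, ‖f1 a‖ ≤ 2 * qnorm a ∧ ‖f2 a‖ ≤ 2 * qnorm a) := by
  refine ⟨?_, ?_, ?_, ?_⟩
  · rintro y ⟨p, rfl⟩ x
    have hI : Complex.I ^ 2 = -1 := Complex.I_sq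
    subst hi2 hi3
    constructor
    · simp [f1, c1, c3, zeta, e1, e2]
      grind
    · simp [f2, c2, c4, zeta, e1, e2]
      grind
  · have h : Continuous (fun q : HC => (q.re, q.imI, q.imJ, q.imK)) := continuous_induced_dom
    have g : Continuous (fun t : ℂ × ℂ × ℂ × ℂ =>
      t.1 - Complex.I * t.2.1 + (-(Complex.I * t.2.2.1) - t.2.2.2)) := by fun_prop
    exact g.comp h
  · have h : Continuous (fun q : HC => (q.re, q.imI, q.imJ, q.imK)) := continuous_induced_dom
    have g : Continuous (fun t : ℂ × ℂ × ℂ × ℂ =>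
      t.1 + Complex.I * t.2.1 + (-(Complex.I * t.2.2.1) + t.2.2.2)) := by fun_prop
    exact g.comp h
  · intro a
    have h1 : ‖c1 a‖ ≤ qnorm a := Real.le_sqrt_of_sq_le (by nlinarith [sq_nonneg ‖c2 a‖, sq_nonneg ‖c3 a‖, sq_nonneg ‖c4 a‖])
    have h2 : ‖c2 a‖ ≤ qnorm a := Real.le_sqrt_of_sq_le (by nlinarith [sq_nonneg ‖c1 a‖, sq_nonneg ‖c3 a‖, sq_nonneg ‖c4 a‖])
    have h3 : ‖c3 a‖ ≤ qnorm a := Real.le_sqrt_of_sq_le (by nlinarith [sq_nonneg ‖c2 a‖, sq_nonneg ‖c1 a‖, sq_nonneg ‖c4 a‖])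
    have h4 : ‖c4 a‖ ≤ qnorm a := Real.le_sqrt_of_sq_le (by nlinarith [sq_nonneg ‖c2 a‖, sq_nonneg ‖c3 a‖, sq_nonneg ‖c1 a‖])
    have k1 := norm_add_le (c1 a) (c3 a)
    have k2 := norm_add_le (c2 a) (c4 a)
    exact ⟨by unfold f1; linarith, by unfold f2; linarith⟩

end
end

section
/- For all x ∈ ℍ(ℂ) and all y ∈ E₃, f̂₁(xy) = f̂₁(x)f̂₁(y) and f̂₂(xy) = f̂₂(x)f̂₂(y); moreover f̂₁ and f̂₂ are continuous, and in fact |f̂₁(a)| ≤ 2‖a‖ and |f̂₂(a)| ≤ 2‖a‖ for every a ∈ ℍ(ℂ). -/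
open Filter Set Topology Quaternion

noncomputable section

theorem aux_mul (x y : HC) (hJ : y.imJ = 0) (hK : y.imK = 0) :
    fh1 (x * y) = fh1 x * fh1 y ∧ fh2 (x * y) = fh2 x * fh2 y := by
  have hI : Complex.I ^ 2 = -1 := Complex.I_sq
  constructor
  · simp only [fh1, c1, c4, QuaternionAlgebra.re_mul, QuaternionAlgebra.imI_mul,
      QuaternionAlgebra.imJ_mul, QuaternionAlgebra.imK_mul, hJ, hK]
    linear_combination (-x.imI * y.imI - x.imJ * y.imI) * hI
  · simp only [fh2, c2, c3, QuaternionAlgebra.re_mul, QuaternionAlgebra.imI_mul,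
      QuaternionAlgebra.imJ_mul, QuaternionAlgebra.imK_mul, hJ, hK]
    linear_combination (-x.imI * y.imI + x.imJ * y.imI) * hI

theorem aux_bound (u v : ℂ) (T : ℝ) (h : ‖u‖ ^ 2 + ‖v‖ ^ 2 ≤ T) :
    ‖u + v‖ ≤ 2 * Real.sqrt T := by
  have h1 : ‖u‖ ≤ Real.sqrt T := Real.le_sqrt_of_sq_le (by nlinarith [sq_nonneg ‖v‖])
  have h2 : ‖v‖ ≤ Real.sqrt T := Real.le_sqrt_of_sq_le (by nlinarith [sq_nonneg ‖u‖])
  linarith [norm_add_le u v]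

/-- Lemma 1, left part: the functionals `f̂₁, f̂₂` are left-multiplicative on
`ℍ(ℂ) × E₃`, continuous, and bounded by `2‖·‖`. -/
theorem statement1 (a₁ a₂ b₁ b₂ : ℂ) (i2 i3 : HC)
    (hi2 : i2 = a₁ • e1 + a₂ • e2) (hi3 : i3 = b₁ • e1 + b₂ • e2)
    (hLI : LinIndep i2 i3) :
    (∀ x : HC, ∀ y ∈ E3 i2 i3,
        fh1 (x * y) = fh1 x * fh1 y ∧ fh2 (x * y) = fh2 x * fh2 y) ∧
    Continuous fh1 ∧ Continuous fh2 ∧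
    (∀ a : HC, ‖fh1 a‖ ≤ 2 * qnorm a ∧ ‖fh2 a‖ ≤ 2 * qnorm a) := by
  have hc : Continuous (fun q : HC => (q.re, q.imI, q.imJ, q.imK)) := continuous_induced_dom
  have h0 : Continuous (fun q : HC => q.re) := hc.fst
  have h1 : Continuous (fun q : HC => q.imI) := hc.snd.fst
  have h2 : Continuous (fun q : HC => q.imJ) := hc.snd.snd.fst
  have h3 : Continuous (fun q : HC => q.imK) := hc.snd.snd.snd
  refine ⟨?_, ?_, ?_, ?_⟩
  · rintro x y ⟨p, rfl⟩
    apply aux_mul <;> simp [zeta, hi2, hi3, e1, e2]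
  · unfold fh1 c1 c4
    fun_prop
  · unfold fh2 c2 c3
    fun_prop
  · intro a
    constructor
    · exact aux_bound _ _ _ (by nlinarith [sq_nonneg ‖c2 a‖, sq_nonneg ‖c3 a‖])
    · exact aux_bound _ _ _ (by nlinarith [sq_nonneg ‖c1 a‖, sq_nonneg ‖c4 a‖])

end
end

section
/- Let ζ = x i₁ + y i₂ + z i₃ ∈ E₃ with ξ₁ = x + y a₁ + z b₁ and ξ₂ = x + y a₂ + z b₂. For every t ∈ ℂ with t ≠ ξ₁ and t ≠ ξ₂, the element t·1 − ζ is invertible in ℍ(ℂ) and (t − ζ)⁻¹ = (t − ξ₁)⁻¹ e₁ + (t − ξ₂)⁻¹ e₂. -/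
open Filter Set Topology Quaternion

noncomputable section

theorem e11 : e1 * e1 = e1 := by
  ext <;> simp [e1] <;> ring_nf <;> simp <;> ring
theorem e22 : e2 * e2 = e2 := by
  ext <;> simp [e2] <;> ring_nf <;> simp <;> ring
theorem e12 : e1 * e2 = 0 := by
  ext <;> simp [e1, e2] <;> ring_nf <;> simp
theorem e21 : e2 * e1 = 0 := by
  ext <;> simp [e1, e2] <;> ring_nf <;> simp
theorem e1_add_e2 : e1 + e2 = 1 := by
  ext <;> simp [e1, e2] <;> ring

theorem diag_mul (p q r s : ℂ) :
    (p • e1 + q • e2) * (r • e1 + s • e2) = (p * r) • e1 + (q * s) • e2 := by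
  simp only [add_mul, mul_add, smul_mul_smul_comm, e11, e22, e12, e21, smul_zero, add_zero,
    zero_add]

/-- Lemma 2: the resolvent decomposition
`(t − ζ)⁻¹ = (t − ξ₁)⁻¹e₁ + (t − ξ₂)⁻¹e₂` for `t ≠ ξ₁, t ≠ ξ₂`. -/
theorem statement6 (a₁ a₂ b₁ b₂ : ℂ) (i2 i3 : HC)
    (hi2 : i2 = a₁ • e1 + a₂ • e2) (hi3 : i3 = b₁ • e1 + b₂ • e2)
    (hLI : LinIndep i2 i3) (x y z : ℝ) (ξ₁ ξ₂ : ℂ)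
    (hξ₁ : ξ₁ = (x : ℂ) + (y : ℂ) * a₁ + (z : ℂ) * b₁)
    (hξ₂ : ξ₂ = (x : ℂ) + (y : ℂ) * a₂ + (z : ℂ) * b₂)
    (t : ℂ) (ht₁ : t ≠ ξ₁) (ht₂ : t ≠ ξ₂) :
    IsUnit (t • (1 : HC) - zeta i2 i3 (x, y, z)) ∧
    (t • (1 : HC) - zeta i2 i3 (x, y, z)) * ((t - ξ₁)⁻¹ • e1 + (t - ξ₂)⁻¹ • e2) = 1 ∧
    ((t - ξ₁)⁻¹ • e1 + (t - ξ₂)⁻¹ • e2) * (t • (1 : HC) - zeta i2 i3 (x, y, z)) = 1 := by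
  have hz : t • (1 : HC) - zeta i2 i3 (x, y, z) = (t - ξ₁) • e1 + (t - ξ₂) • e2 := by
    rw [zeta, hi2, hi3, hξ₁, hξ₂, ← e1_add_e2]
    module
  have h1 : t - ξ₁ ≠ 0 := sub_ne_zero.mpr ht₁
  have h2 : t - ξ₂ ≠ 0 := sub_ne_zero.mpr ht₂
  have hr : (t • (1 : HC) - zeta i2 i3 (x, y, z)) *
      ((t - ξ₁)⁻¹ • e1 + (t - ξ₂)⁻¹ • e2) = 1 := by
    rw [hz, diag_mul, mul_inv_cancel₀ h1, mul_inv_cancel₀ h2, one_smul, one_smul, e1_add_e2]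
  have hl : ((t - ξ₁)⁻¹ • e1 + (t - ξ₂)⁻¹ • e2) *
      (t • (1 : HC) - zeta i2 i3 (x, y, z)) = 1 := by
    rw [hz, diag_mul, inv_mul_cancel₀ h1, inv_mul_cancel₀ h2, one_smul, one_smul, e1_add_e2]
  exact ⟨⟨⟨_, _, hr, hl⟩, rfl⟩, hr, hl⟩

end
end

section
/- Let Ω ⊆ ℝ³ be a domain convex in the directions of the lines L₁ and L₂, assume that at least one number in each of the pairs (a₁, b₁) and (a₂, b₂) lies in ℂ∖ℝ, and let Φ : Ω_ζ → ℍ(ℂ) be right-G-monogenic in Ω_ζ. If ζ₁, ζ₂ ∈ Ω_ζ satisfy ζ₁ − ζ₂ ∈ {x i₁ + y i₂ + z i₃ : (x,y,z) ∈ L₁}, then Φ(ζ₁) − Φ(ζ₂) ∈ 𝓘₁; if ζ₁ − ζ₂ ∈ {x i₁ + y i₂ + z i₃ : (x,y,z) ∈ L₂}, then Φ(ζ₁) − Φ(ζ₂) ∈ 𝓘₂. -/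
open Filter Set Topology Quaternion

noncomputable section

theorem continuous_coords : Continuous (fun q : HC => (q.re, q.imI, q.imJ, q.imK)) :=
  continuous_induced_dom

theorem continuous_c1 : Continuous c1 := by
  have h := continuous_coords
  exact (h.fst).sub (continuous_const.mul h.snd.fst)

theorem continuous_c2 : Continuous c2 := by
  have h := continuous_coords
  exact (h.fst).add (continuous_const.mul h.snd.fst)

theorem continuous_c3 : Continuous c3 := by
  have h := continuous_coords
  exact ((continuous_const.mul h.snd.snd.fst).neg).sub h.snd.snd.snd

theorem continuous_c4 : Continuous c4 := by
  have h := continuous_coords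
  exact ((continuous_const.mul h.snd.snd.fst).neg).add h.snd.snd.snd

theorem continuous_line (z d : HC) : Continuous (fun t : ℝ => z + (t : ℂ) • d) := by
  refine continuous_induced_rng.2 ?_
  simp only [Function.comp_def, QuaternionAlgebra.re_add, QuaternionAlgebra.imI_add,
    QuaternionAlgebra.imJ_add, QuaternionAlgebra.imK_add, QuaternionAlgebra.re_smul,
    QuaternionAlgebra.imI_smul, QuaternionAlgebra.imJ_smul, QuaternionAlgebra.imK_smul,
    smul_eq_mul]
  fun_prop

/-- A linear functional killing `d * q` for all `q` is constant along the direction `d`. -/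
theorem const_along (i2 i3 : HC) (Φ : HC → HC) (S : Set HC) (hΦ : RightGMonogenic i2 i3 Φ S)
    (z d : HC) (hd : d ∈ E3 i2 i3) (hS : ∀ t ∈ Icc (0 : ℝ) 1, z + (t : ℂ) • d ∈ S)
    (c : HC → ℂ) (hc : Continuous c) (hsub : ∀ a b, c (a - b) = c a - c b)
    (hsmul : ∀ (r : ℂ) a, c (r • a) = r * c a) (hk : ∀ q, c (d * q) = 0) :
    c (Φ (z + d)) = c (Φ z) := by
  have hcont : ContinuousOn (fun t : ℝ => c (Φ (z + (t : ℂ) • d))) (Icc 0 1) :=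
    hc.comp_continuousOn (hΦ.1.comp (continuous_line z d).continuousOn hS)
  have hder : ∀ t ∈ Ico (0 : ℝ) 1,
      HasDerivWithinAt (fun t : ℝ => c (Φ (z + (t : ℂ) • d))) 0 (Ici t) t := by
    intro t ht
    obtain ⟨Φ', h'⟩ := hΦ.2 _ (hS t ⟨ht.1, ht.2.le⟩)
    have h1 := (hc.tendsto _).comp (h' d hd)
    rw [hk Φ'] at h1
    rw [← hasDerivWithinAt_Ioi_iff_Ici, hasDerivWithinAt_iff_tendsto_slope' (by simp)]
    have h2 : Tendsto (fun s : ℝ => s - t) (𝓝[>] t) (𝓝[>] 0) := by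
      refine tendsto_nhdsWithin_iff.2 ⟨?_, ?_⟩
      · have : Tendsto (fun s : ℝ => s - t) (𝓝 t) (𝓝 (t - t)) :=
          (continuous_id.sub continuous_const).tendsto t
        rw [sub_self] at this
        exact this.mono_left nhdsWithin_le_nhds
      · filter_upwards [self_mem_nhdsWithin] with s hs
        simpa using hs
    refine (h1.comp h2).congr ?_
    intro s
    have e : z + (t : ℂ) • d + ((s - t : ℝ) : ℂ) • d = z + (s : ℂ) • d := by
      rw [add_assoc, ← add_smul]
      congr 2
      push_cast
      ring
    simp only [Function.comp_apply, e, hsmul, hsub, slope_def_module, Complex.real_smul]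
    push_cast
    rfl
  have := constant_of_has_deriv_right_zero hcont hder 1 (by simp)
  simpa using this

theorem zeta_inj (i2 i3 : HC) (hLI : LinIndep i2 i3) (p q r : ℝ × ℝ × ℝ)
    (h : zeta i2 i3 p - zeta i2 i3 q = zeta i2 i3 r) : p - q = r := by
  have := hLI (p.1 - q.1 - r.1) (p.2.1 - q.2.1 - r.2.1) (p.2.2 - q.2.2 - r.2.2) (by
    rw [← sub_eq_zero] at h
    rw [← h]
    simp only [zeta]
    push_cast
    module)
  obtain ⟨h1, h2, h3⟩ := this
  ext
  · simp; linarith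
  · simp; linarith
  · simp; linarith

/-- The line from `ζ₂` in direction `d` stays in the image of `Ω`. -/
theorem line_mem (i2 i3 : HC) (hLI : LinIndep i2 i3) (Ω L : Set (ℝ × ℝ × ℝ))
    (hconv : ConvexInDirection Ω L) (ζ₁ ζ₂ : HC) (hζ₁ : ζ₁ ∈ zeta i2 i3 '' Ω)
    (hζ₂ : ζ₂ ∈ zeta i2 i3 '' Ω) (h : ζ₁ - ζ₂ ∈ zeta i2 i3 '' L) (t : ℝ) (ht : t ∈ Icc (0 : ℝ) 1) :
    ζ₂ + (t : ℂ) • (ζ₁ - ζ₂) ∈ zeta i2 i3 '' Ω := by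
  obtain ⟨p, hp, rfl⟩ := hζ₁
  obtain ⟨q, hq, rfl⟩ := hζ₂
  obtain ⟨r, hr, he⟩ := h
  have hpq := zeta_inj i2 i3 hLI p q r he.symm
  refine ⟨q + t • (p - q), hconv q hq p hp (hpq ▸ hr) ?_, ?_⟩
  · rw [segment_eq_image']
    exact ⟨t, ht, rfl⟩
  · simp only [zeta, Prod.fst_add, Prod.snd_add, Prod.smul_fst, Prod.smul_snd, Prod.fst_sub,
      Prod.snd_sub, smul_eq_mul]
    push_cast
    module

theorem c1_sub (a b : HC) : c1 (a - b) = c1 a - c1 b := by simp [c1]; ring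
theorem c2_sub (a b : HC) : c2 (a - b) = c2 a - c2 b := by simp [c2]; ring
theorem c3_sub (a b : HC) : c3 (a - b) = c3 a - c3 b := by simp [c3]; ring
theorem c4_sub (a b : HC) : c4 (a - b) = c4 a - c4 b := by simp [c4]; ring
theorem c1_smul (r : ℂ) (a : HC) : c1 (r • a) = r * c1 a := by simp [c1]; ring
theorem c2_smul (r : ℂ) (a : HC) : c2 (r • a) = r * c2 a := by simp [c2]; ring
theorem c3_smul (r : ℂ) (a : HC) : c3 (r • a) = r * c3 a := by simp [c3]; ring
theorem c4_smul (r : ℂ) (a : HC) : c4 (r • a) = r * c4 a := by simp [c4]; ring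

theorem decomp (a : HC) : a = c1 a • e1 + c2 a • e2 + c3 a • e3 + c4 a • e4 := by
  have hI := Complex.I_mul_I
  ext <;> simp [c1, c2, c3, c4, e1, e2, e3, e4] <;> grind

theorem c1_e2_mul (q : HC) : c1 (e2 * q) = 0 := by
  have hI := Complex.I_mul_I
  simp [c1, e2]; grind
theorem c3_e2_mul (q : HC) : c3 (e2 * q) = 0 := by
  have hI := Complex.I_mul_I
  simp [c3, e2]; grind
theorem c2_e1_mul (q : HC) : c2 (e1 * q) = 0 := by
  have hI := Complex.I_mul_I
  simp [c2, e1]; grind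
theorem c4_e1_mul (q : HC) : c4 (e1 * q) = 0 := by
  have hI := Complex.I_mul_I
  simp [c4, e1]; grind

theorem one_eq : (1 : HC) = e1 + e2 := by
  ext <;> simp [e1, e2] <;> norm_num

theorem zeta_eq (a₁ a₂ b₁ b₂ : ℂ) (p : ℝ × ℝ × ℝ) :
    zeta (a₁ • e1 + a₂ • e2) (b₁ • e1 + b₂ • e2) p = xi a₁ b₁ p • e1 + xi a₂ b₂ p • e2 := by
  simp only [zeta, xi, one_eq]
  module

theorem xi_zero (a b : ℂ) (p : ℝ × ℝ × ℝ) (h : p ∈ lineL a b) : xi a b p = 0 := by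
  obtain ⟨h1, h2⟩ := h
  apply Complex.ext
  · simpa [xi] using h1
  · simpa [xi] using h2

/-- Lemma 3: for a right-G-monogenic `Φ` on a domain convex in the directions of
`L₁`, `L₂`, differences along `L₁` (resp. `L₂`) land in the right ideal `𝓘₁` (resp. `𝓘₂`). -/
theorem statement7 (a₁ a₂ b₁ b₂ : ℂ) (i2 i3 : HC)
    (hi2 : i2 = a₁ • e1 + a₂ • e2) (hi3 : i3 = b₁ • e1 + b₂ • e2)
    (hLI : LinIndep i2 i3)
    (Ω : Set (ℝ × ℝ × ℝ)) (hΩo : IsOpen Ω) (hΩc : IsConnected Ω)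
    (hconv1 : ConvexInDirection Ω (lineL a₁ b₁)) (hconv2 : ConvexInDirection Ω (lineL a₂ b₂))
    (hab1 : a₁ ∉ Set.range ((↑) : ℝ → ℂ) ∨ b₁ ∉ Set.range ((↑) : ℝ → ℂ))
    (hab2 : a₂ ∉ Set.range ((↑) : ℝ → ℂ) ∨ b₂ ∉ Set.range ((↑) : ℝ → ℂ))
    (Φ : HC → HC) (hΦ : RightGMonogenic i2 i3 Φ (zeta i2 i3 '' Ω))
    (ζ₁ ζ₂ : HC) (hζ₁ : ζ₁ ∈ zeta i2 i3 '' Ω) (hζ₂ : ζ₂ ∈ zeta i2 i3 '' Ω) :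
    (ζ₁ - ζ₂ ∈ zeta i2 i3 '' lineL a₁ b₁ → Φ ζ₁ - Φ ζ₂ ∈ I1) ∧
    (ζ₁ - ζ₂ ∈ zeta i2 i3 '' lineL a₂ b₂ → Φ ζ₁ - Φ ζ₂ ∈ I2) := by
  subst hi2 hi3
  have hE : ∀ L : Set (ℝ × ℝ × ℝ), ∀ d ∈ zeta (a₁ • e1 + a₂ • e2) (b₁ • e1 + b₂ • e2) '' L,
      d ∈ E3 (a₁ • e1 + a₂ • e2) (b₁ • e1 + b₂ • e2) := by
    rintro L d ⟨p, -, rfl⟩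
    exact ⟨p, rfl⟩
  constructor
  · intro h
    have key := const_along _ _ Φ _ hΦ ζ₂ (ζ₁ - ζ₂) (hE _ _ h)
      (line_mem _ _ hLI Ω _ hconv1 ζ₁ ζ₂ hζ₁ hζ₂ h)
    rw [add_sub_cancel] at key
    obtain ⟨p, hp, he⟩ := h
    rw [zeta_eq, xi_zero _ _ _ hp, zero_smul, zero_add] at he
    have k1 := key c1 continuous_c1 c1_sub c1_smul
      (fun q => by rw [← he, smul_mul_assoc, c1_smul, c1_e2_mul, mul_zero])
    have k3 := key c3 continuous_c3 c3_sub c3_smul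
      (fun q => by rw [← he, smul_mul_assoc, c3_smul, c3_e2_mul, mul_zero])
    refine ⟨c2 (Φ ζ₁ - Φ ζ₂), c4 (Φ ζ₁ - Φ ζ₂), ?_⟩
    have := decomp (Φ ζ₁ - Φ ζ₂)
    rw [c1_sub, c3_sub, k1, k3, sub_self, sub_self, zero_smul, zero_smul, zero_add,
      add_zero] at this
    exact this
  · intro h
    have key := const_along _ _ Φ _ hΦ ζ₂ (ζ₁ - ζ₂) (hE _ _ h)
      (line_mem _ _ hLI Ω _ hconv2 ζ₁ ζ₂ hζ₁ hζ₂ h)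
    rw [add_sub_cancel] at key
    obtain ⟨p, hp, he⟩ := h
    rw [zeta_eq, xi_zero _ _ _ hp, zero_smul, add_zero] at he
    have k2 := key c2 continuous_c2 c2_sub c2_smul
      (fun q => by rw [← he, smul_mul_assoc, c2_smul, c2_e1_mul, mul_zero])
    have k4 := key c4 continuous_c4 c4_sub c4_smul
      (fun q => by rw [← he, smul_mul_assoc, c4_smul, c4_e1_mul, mul_zero])
    refine ⟨c1 (Φ ζ₁ - Φ ζ₂), c3 (Φ ζ₁ - Φ ζ₂), ?_⟩
    have := decomp (Φ ζ₁ - Φ ζ₂)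
    rw [c2_sub, c4_sub, k2, k4, sub_self, sub_self, zero_smul, zero_smul, add_zero,
      add_zero] at this
    exact this

end
end
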